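/- Lemma 4.5, case 2 (type II highest elements): Let n ≥ 2, l ≥ k ≥ 1, let ι : B_l ⊗ B_k → B_k ⊗ B_l be any isomorphism of U_q'(C_n^(1)) crystals and H any energy function for ι. Let y_0 ≥ 1 and x_1, x_2 ≥ 0 be integers with x_1 + x_2 ≤ k and l − k ≥ 2y_0 − x_1, and set x̄_1 = k − x_1 − x_2. If l − k ≤ y_0 or y_0 < x_1 − x̄_1, then, with w = min(l − k, (2y_0 − x_1 + x̄_1)_+) where (t)_+ := max(t, 0), one has ι((l−2y_0,0,---,0) ⊗ (x_1,x_2,---,x̄_1)) = (k−2y_0+2w,0,---,0) ⊗ (x_1+l−k−w, x_2, ---, x̄_1+w), and H((l−2y_0,0,---,0) ⊗ (x_1,x_2,---,x̄_1)) = max(y_0 − l + k, x_1 − x̄_1 − y_0). -/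

import Mathlib

namespace KTT

/-- Raw data of a crystal element `(x_1,…,x_n,x̄_n,…,x̄_1)`:
`b.1 i` is `x_{i+1}` and `b.2 i` is `x̄_{i+1}` for `i : Fin n`. -/
abbrev Tup (n : ℕ) := (Fin n → ℕ) × (Fin n → ℕ)

/-- The entry `x_j` (for `1 ≤ j ≤ n`). -/
def xc {n : ℕ} (b : Tup n) (j : ℕ) : ℕ :=
  if h : j - 1 < n then b.1 ⟨j - 1, h⟩ else 0

/-- The entry `x̄_j` (for `1 ≤ j ≤ n`). -/
def xbc {n : ℕ} (b : Tup n) (j : ℕ) : ℕ :=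
  if h : j - 1 < n then b.2 ⟨j - 1, h⟩ else 0

/-- Set the entry indexed by `j` (i.e. `x_j`) to the value `v`. -/
def setx {n : ℕ} (f : Fin n → ℕ) (j v : ℕ) : Fin n → ℕ :=
  fun t => if (t : ℕ) + 1 = j then v else f t

/-- `Σ_{i=1}^n (x_i + x̄_i)`. -/
def tsum {n : ℕ} (b : Tup n) : ℕ := ∑ i, (b.1 i + b.2 i)

/-- The element `(v,0,…,0)`. -/
def uvec (n v : ℕ) : Tup n := (fun j => if (j : ℕ) = 0 then v else 0, fun _ => 0)

/-- The element `(0,v,---,0)` (only `x_2 = v` nonzero). -/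
def u2vec (n v : ℕ) : Tup n := (fun j => if (j : ℕ) = 1 then v else 0, fun _ => 0)

/-- The element `(0,0,---,v)` (only `x̄_1 = v` nonzero). -/
def barvec (n v : ℕ) : Tup n := (fun _ => 0, fun j => if (j : ℕ) = 0 then v else 0)

/-- The element `(a,c,---,d)` with `x_1 = a`, `x_2 = c`, `x̄_1 = d`, all else `0`. -/
def tripleVec (n a c d : ℕ) : Tup n :=
  (fun j => if (j : ℕ) = 0 then a else if (j : ℕ) = 1 then c else 0,
   fun j => if (j : ℕ) = 0 then d else 0)

/-! ### The `U_q'(C_n^{(1)})` crystal `B_l` -/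

/-- Membership in the `C_n^{(1)}` crystal `B_l` : the sum of the entries belongs to
`{l, l-2, l-4, …}`. -/
def memC (n l : ℕ) (b : Tup n) : Prop := tsum b ≤ l ∧ (l - tsum b) % 2 = 0

def BC (n l : ℕ) : Set (Tup n) := {b | memC n l b}

/-- The number `x_0(b)` of `(0,0̄)` pairs. -/
def x0 (l : ℕ) {n : ℕ} (b : Tup n) : ℕ := (l - tsum b) / 2

/-- The operator `ẽ_i` on `B_l` (C case); `none` plays the role of `0`. -/
def eC (n l i : ℕ) (b : Tup n) : Option (Tup n) :=
  if i = 0 then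
    if 0 < n then
      if xbc b 1 + 2 ≤ xc b 1 then some (setx b.1 1 (xc b 1 - 2), b.2)
      else if xc b 1 = xbc b 1 + 1 then
        some (setx b.1 1 (xc b 1 - 1), setx b.2 1 (xbc b 1 + 1))
      else if tsum b + 2 ≤ l then some (b.1, setx b.2 1 (xbc b 1 + 2))
      else none
    else none
  else if i = n then
    if 0 < xbc b n then some (setx b.1 n (xc b n + 1), setx b.2 n (xbc b n - 1))
    else none
  else if i < n then
    if xbc b (i + 1) < xc b (i + 1) then
      some (setx (setx b.1 i (xc b i + 1)) (i + 1) (xc b (i + 1) - 1), b.2)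
    else if 0 < xbc b i then
      some (b.1, setx (setx b.2 (i + 1) (xbc b (i + 1) + 1)) i (xbc b i - 1))
    else none
  else none

/-- The operator `f̃_i` on `B_l` (C case). -/
def fC (n l i : ℕ) (b : Tup n) : Option (Tup n) :=
  if i = 0 then
    if 0 < n then
      if xbc b 1 ≤ xc b 1 then
        if tsum b + 2 ≤ l then some (setx b.1 1 (xc b 1 + 2), b.2) else none
      else if xc b 1 + 1 = xbc b 1 then
        some (setx b.1 1 (xc b 1 + 1), setx b.2 1 (xbc b 1 - 1))
      else some (b.1, setx b.2 1 (xbc b 1 - 2))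
    else none
  else if i = n then
    if 0 < xc b n then some (setx b.1 n (xc b n - 1), setx b.2 n (xbc b n + 1))
    else none
  else if i < n then
    if xbc b (i + 1) ≤ xc b (i + 1) then
      if 0 < xc b i then
        some (setx (setx b.1 i (xc b i - 1)) (i + 1) (xc b (i + 1) + 1), b.2)
      else none
    else some (b.1, setx (setx b.2 (i + 1) (xbc b (i + 1) - 1)) i (xbc b i + 1))
  else none

def eCIter (n l i m : ℕ) (b : Tup n) : Option (Tup n) :=
  (fun o => Option.bind o (eC n l i))^[m] (some b)

def fCIter (n l i m : ℕ) (b : Tup n) : Option (Tup n) :=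
  (fun o => Option.bind o (fC n l i))^[m] (some b)

/-- `ε_i(b) = max {m | ẽ_i^m b ≠ 0}` (C case). -/
noncomputable def epsC (n l i : ℕ) (b : Tup n) : ℕ :=
  sSup {m | eCIter n l i m b ≠ none}

/-- `φ_i(b) = max {m | f̃_i^m b ≠ 0}` (C case). -/
noncomputable def phiC (n l i : ℕ) (b : Tup n) : ℕ :=
  sSup {m | fCIter n l i m b ≠ none}

/-- `ẽ_i` on the tensor product `B_l ⊗ B_k` (C case). -/
noncomputable def eTenC (n l k i : ℕ) (u : Tup n × Tup n) : Option (Tup n × Tup n) :=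
  if epsC n k i u.2 ≤ phiC n l i u.1 then (eC n l i u.1).map (fun c => (c, u.2))
  else (eC n k i u.2).map (fun c => (u.1, c))

/-- `f̃_i` on the tensor product `B_l ⊗ B_k` (C case). -/
noncomputable def fTenC (n l k i : ℕ) (u : Tup n × Tup n) : Option (Tup n × Tup n) :=
  if epsC n k i u.2 < phiC n l i u.1 then (fC n l i u.1).map (fun c => (c, u.2))
  else (fC n k i u.2).map (fun c => (u.1, c))

/-- `ι : B_l ⊗ B_k → B_k ⊗ B_l` is an isomorphism of `U_q'(C_n^{(1)})` crystals. -/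
def IsIsoC (n l k : ℕ) (ι : Tup n × Tup n → Tup n × Tup n) : Prop :=
  Set.BijOn ι (BC n l ×ˢ BC n k) (BC n k ×ˢ BC n l) ∧
  ∀ u ∈ BC n l ×ˢ BC n k, ∀ i ≤ n,
    Option.map ι (eTenC n l k i u) = eTenC n k l i (ι u) ∧
    Option.map ι (fTenC n l k i u) = fTenC n k l i (ι u)

/-- `H` is an energy function for the isomorphism `ι` (C case), normalized by
`H((l,0,…,0) ⊗ (0,k,---,0)) = 0`. -/
def IsEnergyC (n l k : ℕ) (ι : Tup n × Tup n → Tup n × Tup n)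
    (H : Tup n × Tup n → ℤ) : Prop :=
  (∀ u ∈ BC n l ×ˢ BC n k, ∀ i ≤ n, ∀ v, eTenC n l k i u = some v →
      H v = H u +
        (if i = 0 then
          (if epsC n k 0 u.2 ≤ phiC n l 0 u.1 ∧ epsC n l 0 (ι u).2 ≤ phiC n k 0 (ι u).1
           then 1
           else if phiC n l 0 u.1 < epsC n k 0 u.2 ∧ phiC n k 0 (ι u).1 < epsC n l 0 (ι u).2
           then -1 else 0)
         else 0)) ∧
  H (uvec n l, u2vec n k) = 0

/-! ### The `U_q'(A_{2n-1}^{(2)})` crystal `B_l` -/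

def memA (n l : ℕ) (b : Tup n) : Prop := tsum b = l

def BA (n l : ℕ) : Set (Tup n) := {b | memA n l b}

/-- The operator `ẽ_i` (A case). -/
def eA (n i : ℕ) (b : Tup n) : Option (Tup n) :=
  if i = 0 then
    if 1 < n then
      if xbc b 2 < xc b 2 then some (setx b.1 2 (xc b 2 - 1), setx b.2 1 (xbc b 1 + 1))
      else if 0 < xc b 1 then some (setx b.1 1 (xc b 1 - 1), setx b.2 2 (xbc b 2 + 1))
      else none
    else none
  else if i = n then
    if 0 < xbc b n then some (setx b.1 n (xc b n + 1), setx b.2 n (xbc b n - 1))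
    else none
  else if i < n then
    if xbc b (i + 1) < xc b (i + 1) then
      some (setx (setx b.1 i (xc b i + 1)) (i + 1) (xc b (i + 1) - 1), b.2)
    else if 0 < xbc b i then
      some (b.1, setx (setx b.2 (i + 1) (xbc b (i + 1) + 1)) i (xbc b i - 1))
    else none
  else none

/-- The operator `f̃_i` (A case). -/
def fA (n i : ℕ) (b : Tup n) : Option (Tup n) :=
  if i = 0 then
    if 1 < n then
      if xbc b 2 ≤ xc b 2 then
        if 0 < xbc b 1 then some (setx b.1 2 (xc b 2 + 1), setx b.2 1 (xbc b 1 - 1))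
        else none
      else some (setx b.1 1 (xc b 1 + 1), setx b.2 2 (xbc b 2 - 1))
    else none
  else if i = n then
    if 0 < xc b n then some (setx b.1 n (xc b n - 1), setx b.2 n (xbc b n + 1))
    else none
  else if i < n then
    if xbc b (i + 1) ≤ xc b (i + 1) then
      if 0 < xc b i then
        some (setx (setx b.1 i (xc b i - 1)) (i + 1) (xc b (i + 1) + 1), b.2)
      else none
    else some (b.1, setx (setx b.2 (i + 1) (xbc b (i + 1) - 1)) i (xbc b i + 1))
  else none

def eAIter (n i m : ℕ) (b : Tup n) : Option (Tup n) :=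
  (fun o => Option.bind o (eA n i))^[m] (some b)

def fAIter (n i m : ℕ) (b : Tup n) : Option (Tup n) :=
  (fun o => Option.bind o (fA n i))^[m] (some b)

noncomputable def epsA (n i : ℕ) (b : Tup n) : ℕ :=
  sSup {m | eAIter n i m b ≠ none}

noncomputable def phiA (n i : ℕ) (b : Tup n) : ℕ :=
  sSup {m | fAIter n i m b ≠ none}

/-- `ẽ_i` on a tensor product (A case). -/
noncomputable def eTenA (n i : ℕ) (u : Tup n × Tup n) : Option (Tup n × Tup n) :=
  if epsA n i u.2 ≤ phiA n i u.1 then (eA n i u.1).map (fun c => (c, u.2))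
  else (eA n i u.2).map (fun c => (u.1, c))

/-- `f̃_i` on a tensor product (A case). -/
noncomputable def fTenA (n i : ℕ) (u : Tup n × Tup n) : Option (Tup n × Tup n) :=
  if epsA n i u.2 < phiA n i u.1 then (fA n i u.1).map (fun c => (c, u.2))
  else (fA n i u.2).map (fun c => (u.1, c))

/-- `ι : B_l ⊗ B_k → B_k ⊗ B_l` is an isomorphism of `U_q'(A_{2n-1}^{(2)})` crystals. -/
def IsIsoA (n l k : ℕ) (ι : Tup n × Tup n → Tup n × Tup n) : Prop :=
  Set.BijOn ι (BA n l ×ˢ BA n k) (BA n k ×ˢ BA n l) ∧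
  ∀ u ∈ BA n l ×ˢ BA n k, ∀ i ≤ n,
    Option.map ι (eTenA n i u) = eTenA n i (ι u) ∧
    Option.map ι (fTenA n i u) = fTenA n i (ι u)

/-- `H` is an energy function for `ι` (A case), normalized by
`H((l,0,…,0) ⊗ (0,0,---,k)) = 0`. -/
def IsEnergyA (n l k : ℕ) (ι : Tup n × Tup n → Tup n × Tup n)
    (H : Tup n × Tup n → ℤ) : Prop :=
  (∀ u ∈ BA n l ×ˢ BA n k, ∀ i ≤ n, ∀ v, eTenA n i u = some v →
      H v = H u +
        (if i = 0 then
          (if epsA n 0 u.2 ≤ phiA n 0 u.1 ∧ epsA n 0 (ι u).2 ≤ phiA n 0 (ι u).1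
           then 1
           else if phiA n 0 u.1 < epsA n 0 u.2 ∧ phiA n 0 (ι u).1 < epsA n 0 (ι u).2
           then -1 else 0)
         else 0)) ∧
  H (uvec n l, barvec n k) = 0

/-! ### Words, tableaux and column insertion

Letters are encoded as natural numbers: the unbarred letter `j` (for `0 ≤ j ≤ n`) is `j`,
and the barred letter `j̄` is `2n+1-j`; the natural order of `ℕ` is the order
`0 < 1 < ⋯ < n < n̄ < ⋯ < 1̄ < 0̄`.  A (two-row) tableau is encoded as the list of its
columns (left to right), each column being the list of its entries (top to bottom). -/

/-- The barred partner `j̄` of an unbarred letter `j`. -/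
def bar (n j : ℕ) : ℕ := 2 * n + 1 - j

/-- Column insertion of a letter into a tableau with at most two rows. -/
def insertLetter (n : ℕ) : ℕ → List (List ℕ) → List (List ℕ)
  | a, [] => [[a]]
  | a, [p] :: rest =>
      if a ≤ p then [a] :: insertLetter n p rest else [p, a] :: rest
  | a, [p, q] :: rest =>
      if p ≠ 0 ∧ p ≤ n ∧ q = bar n p ∧ p ≤ a ∧ a ≤ q then
        -- the column is a pair `(x, x̄)` with `x ≠ 0` and `x ≤ a ≤ x̄`
        [p - 1, a] :: insertLetter n (bar n (p - 1)) rest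
      else if n + 1 ≤ q ∧ bar n q < p ∧ p < q ∧ a = bar n q ∧ q ≠ n + 1 then
        -- the column is `(β, x̄)` with `x < β < x̄`, `a = x` and `x ≠ n`
        [a + 1, bar n (a + 1)] :: insertLetter n p rest
      else if a ≤ p then [a, q] :: insertLetter n p rest
      else if a ≤ q then [p, a] :: insertLetter n q rest
      else [p, q, a] :: rest
  | a, C :: rest => (C ++ [a]) :: rest

/-- Column insertion of a word `u = u_1 ⋯ u_j` into a tableau: `u_j` first, `u_1` last. -/
def insertWord (n : ℕ) (u : List ℕ) (T : List (List ℕ)) : List (List ℕ) :=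
  u.foldr (fun a T => insertLetter n a T) T

/-- One step of reverse insertion: letter `g` comes back (moving leftward) into a column;
returns the restored column together with the letter passed further left. -/
def revStep (n g : ℕ) (C : List ℕ) : List ℕ × ℕ :=
  match C with
  | [p] => ([g], p)
  | [p, q] =>
      if p ≠ 0 ∧ p ≤ n ∧ q = bar n p ∧ p ≤ g ∧ g ≤ q then
        ([g, bar n (p - 1)], p - 1)
      else if p ≤ n ∧ g = bar n p ∧ p < q ∧ q < g ∧ p ≠ n then
        ([p + 1, bar n (p + 1)], q)
      else if q ≤ g then ([p, g], q)
      else ([g, q], p)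
  | _ => (C, g)

/-- Reverse insertion of a letter through a list of columns, from right to left;
returns the new columns and the letter ejected from the leftmost column. -/
def revPass (n g : ℕ) : List (List ℕ) → List (List ℕ) × ℕ
  | [] => ([], g)
  | C :: rest =>
      let p := revPass n g rest
      let q := revStep n p.2 C
      (q.1 :: p.1, q.2)

/-- Reverse-bump the rightmost cell of the first row (the last column, a single box). -/
def rbFirst (n : ℕ) (T : List (List ℕ)) : List (List ℕ) × ℕ :=
  match T.getLast? with
  | some [a] => revPass n a T.dropLast
  | _ => (T, 0)

/-- Number of columns of height (at least) two, i.e. the length of the second row. -/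
def numTwoCols (T : List (List ℕ)) : ℕ :=
  (T.filter (fun C => decide (2 ≤ C.length))).length

/-- Reverse-bump the rightmost cell of the second row. -/
def rbSecond (n : ℕ) (T : List (List ℕ)) : List (List ℕ) × ℕ :=
  match (T.drop (numTwoCols T - 1)).head? with
  | some [a, b] =>
      let p := revPass n b (T.take (numTwoCols T - 1))
      (p.1 ++ [a] :: T.drop (numTwoCols T), p.2)
  | _ => (T, 0)

/-- Iterate a reverse-bumping step, collecting the ejected letters in order of ejection. -/
def rbIter (step : List (List ℕ) → List (List ℕ) × ℕ) :
    ℕ → List (List ℕ) → List (List ℕ) × List ℕ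
  | 0, T => (T, [])
  | c + 1, T =>
      let p := step T
      let q := rbIter step c p.1
      (q.1, p.2 :: q.2)

/-- A one-row word regarded as a tableau (list of one-box columns). -/
def rowCols (w : List ℕ) : List (List ℕ) := w.map (fun a => [a])

/-- The row word of a one-row tableau. -/
def colsWord (T : List (List ℕ)) : List ℕ := T.foldr (fun C acc => C ++ acc) []

/-- The word `1^{x_1} ⋯ n^{x_n} n̄^{x̄_n} ⋯ 1̄^{x̄_1}`. -/
def coreWord (n : ℕ) (b : Tup n) : List ℕ :=
  ((List.finRange n).map (fun i => List.replicate (b.1 i) ((i : ℕ) + 1))).foldr (· ++ ·) []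
  ++ ((List.finRange n).reverse.map
      (fun i => List.replicate (b.2 i) (bar n ((i : ℕ) + 1)))).foldr (· ++ ·) []

/-- The word `𝕋(b) = 0^{x_0} 1^{x_1} ⋯ 1̄^{x̄_1} 0̄^{x_0}` of an element of the
`C_n^{(1)}` crystal `B_l`. -/
def rowWordC (n l : ℕ) (b : Tup n) : List ℕ :=
  List.replicate (x0 l b) 0 ++ coreWord n b ++ List.replicate (x0 l b) (bar n 0)

/-- The word `𝕋(b)` with `z` pairs `(0, 0̄)` removed. -/
def hatWordC (n l z : ℕ) (b : Tup n) : List ℕ :=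
  List.replicate (x0 l b - z) 0 ++ coreWord n b ++ List.replicate (x0 l b - z) (bar n 0)

/-- The word `𝒯(b) = 1^{x_1} ⋯ 1̄^{x̄_1}` of an element of the `A_{2n-1}^{(2)}` crystal. -/
def rowWordA (n : ℕ) (b : Tup n) : List ℕ := coreWord n b



section Gen
variable {n : ℕ}

theorem xc_setx (f g : Fin n → ℕ) (j v j' : ℕ) (h1 : 1 ≤ j') (h2 : j' ≤ n) :
    xc ((setx f j v, g) : Tup n) j' = if j' = j then v else xc ((f, g) : Tup n) j' := by
  have h3 : j' - 1 < n := by omega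
  have h4 : j' - 1 + 1 = j' := by omega
  simp [xc, setx, h3, h4]

theorem xbc_setx (f g : Fin n → ℕ) (j v j' : ℕ) (h1 : 1 ≤ j') (h2 : j' ≤ n) :
    xbc ((f, setx g j v) : Tup n) j' = if j' = j then v else xbc ((f, g) : Tup n) j' := by
  have h3 : j' - 1 < n := by omega
  have h4 : j' - 1 + 1 = j' := by omega
  simp [xbc, setx, h3, h4]

theorem xc_snd (f g g' : Fin n → ℕ) (j : ℕ) : xc ((f, g) : Tup n) j = xc ((f, g') : Tup n) j := rfl
theorem xbc_fst (f f' g : Fin n → ℕ) (j : ℕ) : xbc ((f, g) : Tup n) j = xbc ((f', g) : Tup n) j := rfl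

/-- one-sided entry -/
def en (f : Fin n → ℕ) (j : ℕ) : ℕ := if h : j - 1 < n then f ⟨j - 1, h⟩ else 0

theorem xc_en (b : Tup n) (j : ℕ) : xc b j = en b.1 j := (Eq.refl (en b.1 j)).trans (Eq.refl _)
theorem xbc_en (b : Tup n) (j : ℕ) : xbc b j = en b.2 j := (Eq.refl (en b.2 j)).trans (Eq.refl _)

theorem en_setx (f : Fin n → ℕ) (j v j' : ℕ) (h1 : 1 ≤ j') (h2 : j' ≤ n) :
    en (setx f j v) j' = if j' = j then v else en f j' := by
  have h3 : j' - 1 < n := by omega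
  have h4 : j' - 1 + 1 = j' := by omega
  simp [en, setx, h3, h4]

theorem en_ext (f g : Fin n → ℕ) (h : ∀ j, 1 ≤ j → j ≤ n → en f j = en g j) : f = g := by
  funext t
  have := h (t + 1) (by omega) (by omega)
  simpa [en] using this

def sm (f : Fin n → ℕ) : ℕ := ∑ i, f i

theorem sm_setx (f : Fin n → ℕ) (j v : ℕ) (h1 : 1 ≤ j) (h2 : j ≤ n) :
    sm (setx f j v) + en f j = sm f + v := by
  have h3 : j - 1 < n := by omega
  have e : setx f j v = Function.update f ⟨j - 1, h3⟩ v := by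
    funext t
    simp only [setx, Function.update_apply, Fin.ext_iff]
    by_cases h : (t : ℕ) + 1 = j
    · rw [if_pos h, if_pos (by omega)]
    · rw [if_neg h, if_neg (by omega)]
  simp only [sm, en, h3, dif_pos, e]
  rw [Finset.sum_update_of_mem (Finset.mem_univ _)]
  have := Finset.sum_sdiff (f := f) (Finset.subset_univ {(⟨j - 1, h3⟩ : Fin n)})
  rw [Finset.sum_singleton] at this
  omega

theorem tsum_sm (b : Tup n) : tsum b = sm b.1 + sm b.2 := by
  simp [tsum, sm, Finset.sum_add_distrib]

theorem en_le (f : Fin n → ℕ) (j : ℕ) : en f j ≤ sm f := by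
  unfold en sm
  split_ifs with h
  · exact Finset.single_le_sum (f := f) (fun i _ => Nat.zero_le _) (Finset.mem_univ _)
  · simp

def epsF (n l i : ℕ) (b : Tup n) : ℕ :=
  if i = 0 then (l - tsum b) / 2 + (xc b 1 - xbc b 1)
  else if i = n then xbc b n else xbc b i + (xc b (i+1) - xbc b (i+1))

def phiF (n l i : ℕ) (b : Tup n) : ℕ :=
  if i = 0 then (l - tsum b) / 2 + (xbc b 1 - xc b 1)
  else if i = n then xc b n else xc b i + (xbc b (i+1) - xc b (i+1))

theorem eC_none (hn : 2 ≤ n) (l i : ℕ) (hi : i ≤ n) (b : Tup n) (h : eC n l i b = none) :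
    epsF n l i b = 0 := by
  unfold eC at h
  unfold epsF
  split_ifs at h ⊢ <;> simp_all <;> omega

theorem fC_none (hn : 2 ≤ n) (l i : ℕ) (hi : i ≤ n) (b : Tup n) (h : fC n l i b = none) :
    phiF n l i b = 0 := by
  unfold fC at h
  unfold phiF
  split_ifs at h ⊢ <;> simp_all <;> omega

theorem setx2 (f : Fin n → ℕ) (j v v' : ℕ) : setx (setx f j v) j v' = setx f j v' := by
  funext t; simp only [setx]; split_ifs <;> rfl

theorem setx_self (f : Fin n → ℕ) (j : ℕ) (v : ℕ) (h : v = en f j) : setx f j v = f := by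
  subst h
  funext t; simp only [setx, en]; split_ifs with h1 h2
  · congr; omega
  · omega
  · rfl

theorem eC_some (hn : 2 ≤ n) (l i : ℕ) (hi : i ≤ n) (b b' : Tup n) (hb : memC n l b)
    (h : eC n l i b = some b') :
    memC n l b' ∧ epsF n l i b = epsF n l i b' + 1 ∧ phiF n l i b' = phiF n l i b + 1 ∧
      fC n l i b' = some b := by
  obtain ⟨f, g⟩ := b
  obtain ⟨hb1, hb2⟩ := hb
  rw [tsum_sm] at hb1 hb2
  have L1 := en_le f 1
  have L2 := en_le g 1
  unfold eC at h
  rcases Nat.eq_zero_or_pos i with rfl | hi0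
  · simp only [xc_en, xbc_en, tsum_sm, if_true, if_pos (show 0 < n by omega)] at h
    have S1 := fun v => sm_setx f 1 v le_rfl (by omega)
    have S2 := fun v => sm_setx g 1 v le_rfl (by omega)
    simp only [memC, epsF, phiF, fC, if_true, if_pos (show 0 < n by omega), xc_en, xbc_en, tsum_sm]
    split_ifs at h with h1 h2 h3 <;> obtain rfl := Option.some.inj h <;>
      simp only [en_setx _ _ _ 1 le_rfl (show 1 ≤ n by omega), if_true, setx2] at * <;>
      [have S1' := S1 (en f 1 - 2); have S1' := S1 (en f 1 - 1); skip] <;>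
      [skip; have S2' := S2 (en g 1 + 1); have S2' := S2 (en g 1 + 2)] <;>
      refine ⟨⟨by omega, by omega⟩, by omega, by omega, ?_⟩
    · rw [if_pos (by omega), if_pos (by omega), setx_self _ _ _ (by omega)]
    · rw [if_neg (by omega), if_pos (by omega), setx_self _ _ _ (by omega), setx_self _ _ _ (by omega)]
    · rw [if_neg (by omega), if_neg (by omega), setx_self _ _ _ (by omega)]
  rcases Nat.eq_or_lt_of_le hi with rfl | hin
  · rw [if_neg (by omega), if_pos rfl] at h
    have S1 := fun v => sm_setx f i v (by omega) (by omega)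
    have S2 := fun v => sm_setx g i v (by omega) (by omega)
    simp only [memC, epsF, phiF, fC, if_true, if_neg (show ¬ i = 0 by omega), xc_en, xbc_en, tsum_sm] at *
    by_cases h1 : 0 < en g i
    swap
    · rw [if_neg h1] at h; cases h
    rw [if_pos h1] at h
    obtain rfl := Option.some.inj h
    simp only [en_setx _ _ _ i (by omega : 1 ≤ i) (le_refl i), if_true, setx2] at *
    have S1' := S1 (en f i + 1)
    have S2' := S2 (en g i - 1)
    have := en_le g i
    refine ⟨⟨by omega, by omega⟩, by omega, by omega, ?_⟩
    rw [if_pos (by omega), setx_self _ _ _ (by omega), setx_self _ _ _ (by omega)]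
  · rw [if_neg (by omega), if_neg (by omega), if_pos hin] at h
    simp only [memC, epsF, phiF, fC, if_neg (show ¬ i = 0 by omega), if_neg (show ¬ i = n by omega), if_pos hin,
      xc_en, xbc_en, tsum_sm] at *
    have K : ∀ (f : Fin n → ℕ) v v', en (setx (setx f i v) (i+1) v') i = v := fun f v v' => by
      rw [en_setx _ _ _ _ (by omega) (by omega), if_neg (by omega),
        en_setx _ _ _ _ (by omega) (by omega), if_pos rfl]
    have K1 : ∀ (f : Fin n → ℕ) v v', en (setx (setx f i v) (i+1) v') (i+1) = v' := fun f v v' => by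
      rw [en_setx _ _ _ _ (by omega) (by omega), if_pos rfl]
    have C : ∀ (f : Fin n → ℕ) v v', setx (setx f (i+1) v') i v = setx (setx f i v) (i+1) v' := fun f v v' => by
      funext t; simp only [setx]; split_ifs <;> first | rfl | omega
    have S : ∀ (f : Fin n → ℕ) v v', sm (setx (setx f i v) (i+1) v') + en f i + en f (i+1) = sm f + v + v' := fun f v v' => by
      have := sm_setx (setx f i v) (i+1) v' (by omega) (by omega)
      rw [en_setx _ _ _ _ (by omega) (by omega), if_neg (by omega)] at this
      have := sm_setx f i v (by omega) (by omega)
      omega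
    have D : ∀ (f : Fin n → ℕ) v v' u u', u = en f i → u' = en f (i+1) →
        setx (setx (setx (setx f i v) i u) (i+1) v') (i+1) u' = f := fun f v v' u u' h h' => by
      rw [setx2, setx2, ← C, setx_self _ _ _ h', setx_self _ _ _ h]
    by_cases h1 : en g (i+1) < en f (i+1)
    · rw [if_pos h1] at h
      obtain rfl := Option.some.inj h
      simp only [K, K1, C]
      have S1' := S f (en f i + 1) (en f (i+1) - 1)
      refine ⟨⟨by omega, by omega⟩, by omega, by omega, ?_⟩
      rw [if_pos (by omega), if_pos (by omega), D _ _ _ _ _ (by omega) (by omega)]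
    · rw [if_neg h1] at h
      by_cases h2 : 0 < en g i
      swap
      · rw [if_neg h2] at h; cases h
      rw [if_pos h2] at h
      obtain rfl := Option.some.inj h
      simp only [K, K1, C]
      have S1' := S g (en g i - 1) (en g (i+1) + 1)
      refine ⟨⟨by omega, by omega⟩, by omega, by omega, ?_⟩
      rw [if_neg (by omega), D _ _ _ _ _ (by omega) (by omega)]

theorem fC_some (hn : 2 ≤ n) (l i : ℕ) (hi : i ≤ n) (b b' : Tup n) (hb : memC n l b)
    (h : fC n l i b = some b') :
    memC n l b' ∧ phiF n l i b = phiF n l i b' + 1 := by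
  obtain ⟨f, g⟩ := b
  obtain ⟨hb1, hb2⟩ := hb
  rw [tsum_sm] at hb1 hb2
  have L1 := en_le f 1
  have L2 := en_le g 1
  unfold fC at h
  rcases Nat.eq_zero_or_pos i with rfl | hi0
  · simp only [xc_en, xbc_en, tsum_sm, if_true, if_pos (show 0 < n by omega)] at h
    have S1 := fun v => sm_setx f 1 v le_rfl (by omega)
    have S2 := fun v => sm_setx g 1 v le_rfl (by omega)
    simp only [memC, phiF, if_true, xc_en, xbc_en, tsum_sm]
    split_ifs at h with h1 h2 h3 <;> obtain rfl := Option.some.inj h <;>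
      simp only [en_setx _ _ _ 1 le_rfl (show 1 ≤ n by omega), if_true] at * <;>
      [have S1' := S1 (en f 1 + 2); have S1' := S1 (en f 1 + 1); skip] <;>
      [skip; have S2' := S2 (en g 1 - 1); have S2' := S2 (en g 1 - 2)] <;>
      refine ⟨⟨by omega, by omega⟩, by omega⟩
  rcases Nat.eq_or_lt_of_le hi with rfl | hin
  · rw [if_neg (by omega), if_pos rfl] at h
    have S1 := fun v => sm_setx f i v (by omega) (by omega)
    have S2 := fun v => sm_setx g i v (by omega) (by omega)
    simp only [memC, phiF, if_true, if_neg (show ¬ i = 0 by omega), xc_en, xbc_en, tsum_sm] at *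
    by_cases h1 : 0 < en f i
    swap
    · rw [if_neg h1] at h; cases h
    rw [if_pos h1] at h
    obtain rfl := Option.some.inj h
    simp only [en_setx _ _ _ i (by omega : 1 ≤ i) (le_refl i), if_true] at *
    have S1' := S1 (en f i - 1)
    have S2' := S2 (en g i + 1)
    have := en_le f i
    refine ⟨⟨by omega, by omega⟩, by omega⟩
  · rw [if_neg (by omega), if_neg (by omega), if_pos hin] at h
    simp only [memC, phiF, if_neg (show ¬ i = 0 by omega), if_neg (show ¬ i = n by omega),
      xc_en, xbc_en, tsum_sm] at *
    have K : ∀ (f : Fin n → ℕ) v v', en (setx (setx f i v) (i+1) v') i = v := fun f v v' => by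
      rw [en_setx _ _ _ _ (by omega) (by omega), if_neg (by omega),
        en_setx _ _ _ _ (by omega) (by omega), if_pos rfl]
    have K1 : ∀ (f : Fin n → ℕ) v v', en (setx (setx f i v) (i+1) v') (i+1) = v' := fun f v v' => by
      rw [en_setx _ _ _ _ (by omega) (by omega), if_pos rfl]
    have C : ∀ (f : Fin n → ℕ) v v', setx (setx f (i+1) v') i v = setx (setx f i v) (i+1) v' := fun f v v' => by
      funext t; simp only [setx]; split_ifs <;> first | rfl | omega
    have S : ∀ (f : Fin n → ℕ) v v', sm (setx (setx f i v) (i+1) v') + en f i + en f (i+1) = sm f + v + v' := fun f v v' => by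
      have := sm_setx (setx f i v) (i+1) v' (by omega) (by omega)
      rw [en_setx _ _ _ _ (by omega) (by omega), if_neg (by omega)] at this
      have := sm_setx f i v (by omega) (by omega)
      omega
    by_cases h1 : en g (i+1) ≤ en f (i+1)
    · rw [if_pos h1] at h
      by_cases h2 : 0 < en f i
      swap
      · rw [if_neg h2] at h; cases h
      rw [if_pos h2] at h
      obtain rfl := Option.some.inj h
      simp only [K, K1]
      have S1' := S f (en f i - 1) (en f (i+1) + 1)
      refine ⟨⟨by omega, by omega⟩, by omega⟩
    · rw [if_neg h1] at h
      obtain rfl := Option.some.inj h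
      simp only [K, K1, C]
      have S1' := S g (en g i + 1) (en g (i+1) - 1)
      refine ⟨⟨by omega, by omega⟩, by omega⟩

theorem iter_sup {α : Type*} (e : α → Option α) (M : α → Prop) (g : α → ℕ)
    (h0 : ∀ b, M b → e b = none → g b = 0)
    (h1 : ∀ b b', M b → e b = some b' → M b' ∧ g b = g b' + 1) (b : α) (hb : M b) :
    sSup {m | (fun o => Option.bind o e)^[m] (some b) ≠ none} = g b := by
  have hnone : ∀ m, (fun o => Option.bind o e)^[m] none = none := by
    intro m; induction m with
    | zero => rfl
    | succ m ih => rw [Function.iterate_succ_apply]; exact ih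
  have key : ∀ m b, M b → ((fun o => Option.bind o e)^[m] (some b) ≠ none ↔ m ≤ g b) := by
    intro m
    induction m with
    | zero => intro b _; simp
    | succ m ih =>
      intro b hb
      rw [Function.iterate_succ_apply]
      change ((fun o => Option.bind o e)^[m] (e b) ≠ none ↔ _)
      cases hE : e b with
      | none => rw [hnone]; have := h0 b hb hE; simp [this]
      | some b' =>
        obtain ⟨q, q'⟩ := h1 b b' hb hE
        rw [ih b' q]; omega
  have : {m | (fun o => Option.bind o e)^[m] (some b) ≠ none} = Set.Iic (g b) := by
    ext m; exact key m b hb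
  rw [this, csSup_Iic]

theorem epsC_eq (hn : 2 ≤ n) (l i : ℕ) (hi : i ≤ n) (b : Tup n) (hb : memC n l b) :
    epsC n l i b = epsF n l i b :=
  iter_sup (eC n l i) (memC n l) (epsF n l i) (fun b _ h => eC_none hn l i hi b h)
    (fun b b' hb h => ⟨(eC_some hn l i hi b b' hb h).1, (eC_some hn l i hi b b' hb h).2.1⟩) b hb

theorem phiC_eq (hn : 2 ≤ n) (l i : ℕ) (hi : i ≤ n) (b : Tup n) (hb : memC n l b) :
    phiC n l i b = phiF n l i b :=
  iter_sup (fC n l i) (memC n l) (phiF n l i) (fun b _ h => fC_none hn l i hi b h)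
    (fun b b' hb h => fC_some hn l i hi b b' hb h) b hb

end Gen

section Ten
variable {n : ℕ}

/-- one step of `ẽ_i` on a tensor product, on the left (`true`) or on the right (`false`) -/
def St (n l k i : ℕ) (s : Bool) (u v : Tup n × Tup n) : Prop :=
  memC n l u.1 ∧ memC n k u.2 ∧
    if s = true then (epsF n k i u.2 ≤ phiF n l i u.1 ∧ eC n l i u.1 = some v.1 ∧ v.2 = u.2)
    else (phiF n l i u.1 < epsF n k i u.2 ∧ eC n k i u.2 = some v.2 ∧ v.1 = u.1)

theorem St_mem (hn : 2 ≤ n) {l k i : ℕ} (hi : i ≤ n) {s : Bool} {u v : Tup n × Tup n}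
    (h : St n l k i s u v) : memC n l v.1 ∧ memC n k v.2 := by
  obtain ⟨h1, h2, h3⟩ := h
  cases s
  · simp only [Bool.false_eq_true, if_false] at h3
    obtain ⟨a, b, c⟩ := h3
    rw [c]; exact ⟨h1, (eC_some hn k i hi _ _ h2 b).1⟩
  · simp only [if_true] at h3
    obtain ⟨a, b, c⟩ := h3
    rw [c]; exact ⟨(eC_some hn l i hi _ _ h1 b).1, h2⟩

theorem St_e (hn : 2 ≤ n) {l k i : ℕ} (hi : i ≤ n) {s : Bool} {u v : Tup n × Tup n}
    (h : St n l k i s u v) : eTenC n l k i u = some v := by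
  obtain ⟨h1, h2, h3⟩ := h
  unfold eTenC
  rw [epsC_eq hn k i hi _ h2, phiC_eq hn l i hi _ h1]
  cases s
  · simp only [Bool.false_eq_true, if_false] at h3
    obtain ⟨a, b, c⟩ := h3
    rw [if_neg (by omega), b]; simp [← c]
  · simp only [if_true] at h3
    obtain ⟨a, b, c⟩ := h3
    rw [if_pos (by omega), b]; simp [← c]

theorem St_f (hn : 2 ≤ n) {l k i : ℕ} (hi : i ≤ n) {s : Bool} {u v : Tup n × Tup n}
    (h : St n l k i s u v) : fTenC n l k i v = some u := by
  have hm := St_mem hn hi h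
  obtain ⟨h1, h2, h3⟩ := h
  unfold fTenC
  rw [epsC_eq hn k i hi _ hm.2, phiC_eq hn l i hi _ hm.1]
  cases s
  · simp only [Bool.false_eq_true, if_false] at h3
    obtain ⟨a, b, c⟩ := h3
    obtain ⟨_, p, q, r⟩ := eC_some hn k i hi _ _ h2 b
    rw [c, if_neg (by omega), r]; simp
  · simp only [if_true] at h3
    obtain ⟨a, b, c⟩ := h3
    obtain ⟨_, p, q, r⟩ := eC_some hn l i hi _ _ h1 b
    rw [c, if_pos (by omega), r]; simp

theorem St_of_e (hn : 2 ≤ n) {l k i : ℕ} (hi : i ≤ n) {u v : Tup n × Tup n}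
    (h1 : memC n l u.1) (h2 : memC n k u.2) (h : eTenC n l k i u = some v) :
    ∃ s, St n l k i s u v := by
  unfold eTenC at h
  rw [epsC_eq hn k i hi _ h2, phiC_eq hn l i hi _ h1] at h
  by_cases hc : epsF n k i u.2 ≤ phiF n l i u.1
  · rw [if_pos hc, Option.map_eq_some_iff] at h
    obtain ⟨a, ha, rfl⟩ := h
    exact ⟨true, h1, h2, by simp [hc, ha]⟩
  · rw [if_neg hc, Option.map_eq_some_iff] at h
    obtain ⟨a, ha, rfl⟩ := h
    exact ⟨false, h1, h2, by simp [ha]; omega⟩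

def dl (i : ℕ) (s s' : Bool) : ℤ :=
  if i = 0 then (if s = true ∧ s' = true then 1 else if s = false ∧ s' = false then -1 else 0) else 0

theorem dl_tt (i : ℕ) : dl i true true = if i = 0 then 1 else 0 := by simp [dl]
theorem dl_tf (i : ℕ) : dl i true false = 0 := by simp [dl]
theorem dl_ft (i : ℕ) : dl i false true = 0 := by simp [dl]
theorem dl_ff (i : ℕ) : dl i false false = if i = 0 then -1 else 0 := by simp [dl]

theorem St_cond {l k i : ℕ} {s : Bool} {u v : Tup n × Tup n}
    (h : St n l k i s u v) : (epsF n k i u.2 ≤ phiF n l i u.1 ↔ s = true) := by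
  obtain ⟨h1, h2, h3⟩ := h
  cases s
  · simp only [Bool.false_eq_true, if_false] at h3
    simp; omega
  · simp only [if_true] at h3
    simp; omega

/-- `ι u = u'` and `H u = h` -/
def PP (n l k : ℕ) (ι : Tup n × Tup n → Tup n × Tup n) (H : Tup n × Tup n → ℤ)
    (u u' : Tup n × Tup n) (h : ℤ) : Prop :=
  ι u = u' ∧ H u = h

theorem PP_step (hn : 2 ≤ n) {l k i : ℕ} (hi : i ≤ n)
    {ι : Tup n × Tup n → Tup n × Tup n} (hι : IsIsoC n l k ι)
    {H : Tup n × Tup n → ℤ} (hH : IsEnergyC n l k ι H)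
    {s s' : Bool} {u v u' v' : Tup n × Tup n} {h h' : ℤ}
    (h1 : St n l k i s u v) (h2 : St n k l i s' u' v') (hh : h' = h + dl i s s') :
    PP n l k ι H u u' h ↔ PP n l k ι H v v' h' := by
  have mu : u ∈ BC n l ×ˢ BC n k := ⟨h1.1, h1.2.1⟩
  have mv : v ∈ BC n l ×ˢ BC n k := ⟨(St_mem hn hi h1).1, (St_mem hn hi h1).2⟩
  have key : ι u = u' → H v = H u + dl i s s' := by
    intro e
    rw [hH.1 u mu i hi v (St_e hn hi h1), e]
    congr 1
    unfold dl
    by_cases hi0 : i = 0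
    · subst hi0
      have c1 := St_cond h1
      have c2 := St_cond h2
      rw [epsC_eq hn k 0 hi _ h1.2.1, phiC_eq hn l 0 hi _ h1.1,
        epsC_eq hn l 0 hi _ h2.2.1, phiC_eq hn k 0 hi _ h2.1]
      simp only [if_true, ← not_le, c1, c2, Bool.not_eq_true]
    · simp [hi0]
  constructor
  · rintro ⟨e, e'⟩
    refine ⟨?_, by rw [key e, e', hh]⟩
    have := (hι.2 u mu i hi).1
    rw [St_e hn hi h1, e, St_e hn hi h2] at this
    exact Option.some.inj this
  · rintro ⟨e, e'⟩
    have := (hι.2 v mv i hi).2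
    rw [St_f hn hi h1, e, St_f hn hi h2] at this
    have e2 := Option.some.inj this
    have := key e2
    exact ⟨e2, by omega⟩

/-- `p` steps on the right, then `q` steps on the left -/
def RL (n l k i : ℕ) : ℕ → ℕ → Tup n × Tup n → Tup n × Tup n → Prop
  | 0, 0, u, v => u = v
  | 0, q + 1, u, v => ∃ t, St n l k i true u t ∧ RL n l k i 0 q t v
  | p + 1, q, u, v => ∃ t, St n l k i false u t ∧ RL n l k i p q t v

theorem PP_RL (hn : 2 ≤ n) {l k i : ℕ} (hi : i ≤ n)
    {ι : Tup n × Tup n → Tup n × Tup n} (hι : IsIsoC n l k ι)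
    {H : Tup n × Tup n → ℤ} (hH : IsEnergyC n l k ι H) :
    ∀ (N p q p' q' : ℕ) (u v u' v' : Tup n × Tup n) (h h' : ℤ), p + q = N → p' + q' = N →
      RL n l k i p q u v → RL n k l i p' q' u' v' →
      h' = h + (if i = 0 then ((min q q' : ℕ) : ℤ) - ((min p p' : ℕ) : ℤ) else 0) →
      (PP n l k ι H u u' h ↔ PP n l k ι H v v' h') := by
  intro N
  induction N with
  | zero =>
    intro p q p' q' u v u' v' h h' e1 e2 r1 r2 hh
    obtain ⟨rfl, rfl⟩ : p = 0 ∧ q = 0 := by omega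
    obtain ⟨rfl, rfl⟩ : p' = 0 ∧ q' = 0 := by omega
    simp only [RL] at r1 r2
    subst r1 r2
    simp at hh; rw [hh]
  | succ N ih =>
    intro p q p' q' u v u' v' h h' e1 e2 r1 r2 hh
    rcases p with _ | p <;> rcases p' with _ | p'
    · obtain rfl : q = N + 1 := by omega
      obtain rfl : q' = N + 1 := by omega
      simp only [RL] at r1 r2
      obtain ⟨t, s1, r1⟩ := r1
      obtain ⟨t', s2, r2⟩ := r2
      rw [PP_step hn hi hι hH s1 s2 rfl]
      refine ih _ _ _ _ _ _ _ _ _ _ (by omega) (by omega) r1 r2 ?_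
      rw [hh, dl_tt]; split_ifs <;> omega
    · obtain rfl : q = N + 1 := by omega
      simp only [RL] at r1 r2
      obtain ⟨t, s1, r1⟩ := r1
      obtain ⟨t', s2, r2⟩ := r2
      rw [PP_step hn hi hι hH s1 s2 rfl]
      refine ih _ _ _ _ _ _ _ _ _ _ (by omega) (by omega) r1 r2 ?_
      rw [hh, dl_tf]; split_ifs <;> omega
    · obtain rfl : q' = N + 1 := by omega
      simp only [RL] at r1 r2
      obtain ⟨t, s1, r1⟩ := r1
      obtain ⟨t', s2, r2⟩ := r2
      rw [PP_step hn hi hι hH s1 s2 rfl]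
      refine ih _ _ _ _ _ _ _ _ _ _ (by omega) (by omega) r1 r2 ?_
      rw [hh, dl_ft]; split_ifs <;> omega
    · simp only [RL] at r1 r2
      obtain ⟨t, s1, r1⟩ := r1
      obtain ⟨t', s2, r2⟩ := r2
      rw [PP_step hn hi hι hH s1 s2 rfl]
      refine ih _ _ _ _ _ _ _ _ _ _ (by omega) (by omega) r1 r2 ?_
      rw [hh, dl_ff]; split_ifs <;> omega

def Es (n l i : ℕ) : ℕ → Tup n → Tup n → Prop
  | 0, b, b' => b = b'
  | m + 1, b, b' => ∃ t, eC n l i b = some t ∧ Es n l i m t b'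

theorem Es_add {l i : ℕ} : ∀ (m m' : ℕ) (b b' b'' : Tup n), Es n l i m b b' → Es n l i m' b' b'' →
    Es n l i (m + m') b b'' := by
  intro m
  induction m with
  | zero => intro m' b b' b'' h h'; cases h; simpa using h'
  | succ m ih =>
    intro m' b b' b'' h h'
    obtain ⟨t, ht, h⟩ := h
    rw [Nat.succ_add]
    exact ⟨t, ht, ih _ _ _ _ h h'⟩

theorem Es_one {l i : ℕ} {b b' : Tup n} (h : eC n l i b = some b') : Es n l i 1 b b' :=
  ⟨b', h, rfl⟩

theorem Es_mem (hn : 2 ≤ n) {l i : ℕ} (hi : i ≤ n) : ∀ (m : ℕ) (b b' : Tup n), memC n l b →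
    Es n l i m b b' → memC n l b' ∧ epsF n l i b = epsF n l i b' + m := by
  intro m
  induction m with
  | zero => intro b b' hb h; cases h; exact ⟨hb, rfl⟩
  | succ m ih =>
    intro b b' hb h
    obtain ⟨t, ht, h⟩ := h
    have := eC_some hn l i hi _ _ hb ht
    have := ih _ _ this.1 h
    exact ⟨this.1, by omega⟩

theorem RL_mk (hn : 2 ≤ n) {l k i : ℕ} (hi : i ≤ n) : ∀ (p q : ℕ) (b1 b1' b2 b2' : Tup n),
    memC n l b1 → memC n k b2 → Es n k i p b2 b2' → Es n l i q b1 b1' →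
    (p = 0 ∨ phiF n l i b1 ≤ epsF n k i b2') → (q = 0 ∨ epsF n k i b2' ≤ phiF n l i b1) →
    RL n l k i p q (b1, b2) (b1', b2') := by
  intro p
  induction p with
  | zero =>
    intro q
    induction q with
    | zero =>
      intro b1 b1' b2 b2' m1 m2 e1 e2 _ _
      cases e1; cases e2; simp only [RL]
    | succ q ih =>
      intro b1 b1' b2 b2' m1 m2 e1 e2 _ h
      cases e1
      obtain ⟨t, ht, e2⟩ := e2
      have q1 := eC_some hn l i hi _ _ m1 ht
      simp only [RL]
      refine ⟨(t, b2), ⟨m1, m2, ?_⟩, ih _ _ _ _ q1.1 m2 rfl e2 (Or.inl rfl) ?_⟩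
      · simp only [if_true]; exact ⟨by omega, ht, trivial⟩
      · omega
  | succ p ih =>
    intro q b1 b1' b2 b2' m1 m2 e1 e2 h h'
    have hm := Es_mem hn hi _ _ _ m2 e1
    obtain ⟨t, ht, e1⟩ := e1
    have q1 := eC_some hn k i hi _ _ m2 ht
    simp only [RL]
    refine ⟨(b1, t), ⟨m1, m2, ?_⟩, ih _ _ _ _ _ m1 q1.1 e1 e2 (by omega) h'⟩
    simp only [Bool.false_eq_true, if_false]
    exact ⟨by omega, ht, trivial⟩

/-- total number of steps available -/
theorem RL_eps (hn : 2 ≤ n) {l k i : ℕ} (hi : i ≤ n)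
    {ι : Tup n × Tup n → Tup n × Tup n} (hι : IsIsoC n l k ι) :
    ∀ (N p q : ℕ) (u v : Tup n × Tup n), p + q = N → RL n l k i p q u v →
      u ∈ BC n l ×ˢ BC n k →
      N ≤ epsF n k i (ι u).1 + epsF n l i (ι u).2 := by
  intro N
  induction N with
  | zero => intros; omega
  | succ N ih =>
    intro p q u v e r mu
    obtain ⟨t, s, p', q', st, e', r'⟩ : ∃ t s p' q', St n l k i s u t ∧ p' + q' = N ∧
        RL n l k i p' q' t v := by
      rcases p with _ | p
      · obtain rfl : q = N + 1 := by omega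
        simp only [RL] at r
        obtain ⟨t, s1, r⟩ := r
        exact ⟨t, _, _, _, s1, by omega, r⟩
      · simp only [RL] at r
        obtain ⟨t, s1, r⟩ := r
        exact ⟨t, _, _, _, s1, by omega, r⟩
    have mt := St_mem hn hi st
    have := ih _ _ _ _ e' r' ⟨mt.1, mt.2⟩
    have hE := (hι.2 u mu i hi).1
    rw [St_e hn hi st] at hE
    have mi := hι.1.mapsTo mu
    obtain ⟨s', st'⟩ := St_of_e hn hi mi.1 mi.2 hE.symm
    obtain ⟨a1, a2, a3⟩ := st'
    cases s'
    · simp only [Bool.false_eq_true, if_false] at a3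
      obtain ⟨_, b, c⟩ := a3
      have := (eC_some hn l i hi _ _ a2 b).2.1
      have := congrArg (epsF n k i) c
      omega
    · simp only [if_true] at a3
      obtain ⟨_, b, c⟩ := a3
      have := (eC_some hn k i hi _ _ a1 b).2.1
      have := congrArg (epsF n l i) c
      omega

end Ten

section QQ
variable {n : ℕ}

def Q (n x1 x2 b2 b1 : ℕ) : Tup n :=
  (fun j => if (j : ℕ) = 0 then x1 else if (j : ℕ) = 1 then x2 else 0,
   fun j => if (j : ℕ) = 0 then b1 else if (j : ℕ) = 1 then b2 else 0)

theorem xc1_Q (hn : 2 ≤ n) (x1 x2 b2 b1 : ℕ) : xc (Q n x1 x2 b2 b1) 1 = x1 := by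
  simp [xc, Q]; omega
theorem xc2_Q (hn : 2 ≤ n) (x1 x2 b2 b1 : ℕ) : xc (Q n x1 x2 b2 b1) 2 = x2 := by
  simp [xc, Q]; omega
theorem xbc1_Q (hn : 2 ≤ n) (x1 x2 b2 b1 : ℕ) : xbc (Q n x1 x2 b2 b1) 1 = b1 := by
  simp [xbc, Q]; omega
theorem xbc2_Q (hn : 2 ≤ n) (x1 x2 b2 b1 : ℕ) : xbc (Q n x1 x2 b2 b1) 2 = b2 := by
  simp [xbc, Q]; omega

theorem tsum_Q (hn : 2 ≤ n) (x1 x2 b2 b1 : ℕ) : tsum (Q n x1 x2 b2 b1) = x1 + x2 + b2 + b1 := by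
  obtain ⟨m, rfl⟩ : ∃ m, n = m + 2 := ⟨n - 2, by omega⟩
  simp [tsum, Q, Fin.sum_univ_succ]
  omega

theorem mem_Q (hn : 2 ≤ n) {l x1 x2 b2 b1 : ℕ} (h : x1 + x2 + b2 + b1 ≤ l)
    (h' : (l - (x1 + x2 + b2 + b1)) % 2 = 0) : memC n l (Q n x1 x2 b2 b1) := by
  unfold memC; rw [tsum_Q hn]; exact ⟨h, h'⟩

theorem eps0_Q (hn : 2 ≤ n) (l x1 x2 b2 b1 : ℕ) :
    epsF n l 0 (Q n x1 x2 b2 b1) = (l - (x1 + x2 + b2 + b1)) / 2 + (x1 - b1) := by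
  simp [epsF, tsum_Q hn, xc1_Q hn, xbc1_Q hn]
theorem phi0_Q (hn : 2 ≤ n) (l x1 x2 b2 b1 : ℕ) :
    phiF n l 0 (Q n x1 x2 b2 b1) = (l - (x1 + x2 + b2 + b1)) / 2 + (b1 - x1) := by
  simp [phiF, tsum_Q hn, xc1_Q hn, xbc1_Q hn]
theorem eps1_Q (hn : 2 ≤ n) (l x1 x2 b2 b1 : ℕ) :
    epsF n l 1 (Q n x1 x2 b2 b1) = b1 + (x2 - b2) := by
  have : ¬ 1 = n := by omega
  simp [epsF, xbc1_Q hn, xc2_Q hn, xbc2_Q hn, this]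
theorem phi1_Q (hn : 2 ≤ n) (l x1 x2 b2 b1 : ℕ) :
    phiF n l 1 (Q n x1 x2 b2 b1) = x1 + (b2 - x2) := by
  have : ¬ 1 = n := by omega
  simp [phiF, xc1_Q hn, xc2_Q hn, xbc2_Q hn, this]

theorem setx_congr (f g : Fin n → ℕ) (h : ∀ t : Fin n, f t = g t) : f = g := funext h

theorem e0a (hn : 2 ≤ n) (l x1 x2 b2 b1 y : ℕ) (h : b1 ≤ y) (h' : x1 = y + 2) :
    eC n l 0 (Q n x1 x2 b2 b1) = some (Q n y x2 b2 b1) := by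
  have h0 : 0 < n := by omega
  simp only [eC, xc1_Q hn, xbc1_Q hn, if_true, h0]
  rw [if_pos (by omega)]
  congr 1; ext t <;> simp only [Q, setx] <;> split_ifs <;> omega

theorem e0b (hn : 2 ≤ n) (l x2 b2 b1 : ℕ) :
    eC n l 0 (Q n (b1 + 1) x2 b2 b1) = some (Q n b1 x2 b2 (b1 + 1)) := by
  have h0 : 0 < n := by omega
  simp only [eC, xc1_Q hn, xbc1_Q hn, if_true, h0]
  rw [if_neg (by omega)]
  congr 1; ext t <;> simp only [Q, setx] <;> split_ifs <;> omega

theorem e0c (hn : 2 ≤ n) (l x1 x2 b2 b1 : ℕ) (h : x1 ≤ b1) (h' : x1 + x2 + b2 + b1 + 2 ≤ l) :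
    eC n l 0 (Q n x1 x2 b2 b1) = some (Q n x1 x2 b2 (b1 + 2)) := by
  have h0 : 0 < n := by omega
  simp only [eC, xc1_Q hn, xbc1_Q hn, if_true, h0, tsum_Q hn]
  rw [if_neg (by omega), if_neg (by omega), if_pos (by omega)]
  congr 1; ext t <;> simp only [Q, setx] <;> split_ifs <;> omega

theorem e1x (hn : 2 ≤ n) (l x1 x2 b2 b1 : ℕ) (h : b2 ≤ x2) :
    eC n l 1 (Q n x1 (x2 + 1) b2 b1) = some (Q n (x1 + 1) x2 b2 b1) := by
  have h0 : ¬ 1 = n := by omega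
  have h1 : 1 < n := by omega
  simp only [eC, xc1_Q hn, xc2_Q hn, xbc1_Q hn, xbc2_Q hn, h0, h1, if_true, if_false, one_ne_zero, Nat.reduceAdd]
  rw [if_pos (by omega)]
  congr 1; ext t <;> simp only [Q, setx] <;> split_ifs <;> omega

theorem e1b (hn : 2 ≤ n) (l x1 x2 b2 b1 : ℕ) (h : x2 ≤ b2) :
    eC n l 1 (Q n x1 x2 b2 (b1 + 1)) = some (Q n x1 x2 (b2 + 1) b1) := by
  have h0 : ¬ 1 = n := by omega
  have h1 : 1 < n := by omega
  simp only [eC, xc1_Q hn, xc2_Q hn, xbc1_Q hn, xbc2_Q hn, h0, h1, if_true, if_false, one_ne_zero, Nat.reduceAdd]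
  rw [if_neg (by omega), if_pos (by omega)]
  congr 1; ext t <;> simp only [Q, setx] <;> split_ifs <;> omega

theorem E0shift (hn : 2 ≤ n) (l m a x2 b2 d : ℕ) : ∀ x, x = a + 2 * m → d ≤ a →
    Es n l 0 m (Q n x x2 b2 d) (Q n a x2 b2 d) := by
  induction m with
  | zero => rintro x rfl _; simp [Es]
  | succ m ih =>
    intro x hx hd
    exact ⟨_, e0a hn l x x2 b2 d (a + 2 * m) (by omega) (by omega), ih _ rfl hd⟩

theorem E0swap (hn : 2 ≤ n) (l x2 b2 d : ℕ) (m : ℕ) : ∀ a, a = d + m → a + x2 + b2 + d ≤ l →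
    Es n l 0 m (Q n a x2 b2 d) (Q n d x2 b2 a) := by
  induction m using Nat.strong_induction_on with
  | _ m ih =>
    intro a ha hs
    subst ha
    rcases m with _ | _ | m
    · simp [Es]
    · exact Es_one (e0b hn l x2 b2 d)
    · have h1 := Es_one (e0a hn l (d + (m + 1 + 1)) x2 b2 d (d + m) (by omega) (by omega))
      have h2 := ih m (by omega) (d + m) rfl (by omega)
      have h3 := Es_one (e0c hn l d x2 b2 (d + m) (by omega) (by omega))
      have := Es_add _ _ _ _ _ h1 (Es_add _ _ _ _ _ h2 h3)
      have e : 1 + (m + 1) = m + 1 + 1 := by omega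
      rw [e] at this
      exact this

theorem E1x (hn : 2 ≤ n) (l m x2' b2 b1 : ℕ) (hb : b2 ≤ x2') : ∀ x1 x1' x2, x1' = x1 + m →
    x2 = x2' + m → Es n l 1 m (Q n x1 x2 b2 b1) (Q n x1' x2' b2 b1) := by
  induction m with
  | zero => rintro x1 x1' x2 rfl rfl; simp [Es]
  | succ m ih =>
    rintro x1 x1' x2 h1 h2
    obtain rfl : x2 = (x2' + m) + 1 := by omega
    exact ⟨_, e1x hn l x1 (x2' + m) b2 b1 (by omega), ih _ _ _ (by omega) rfl⟩

theorem E1b (hn : 2 ≤ n) (l m x1 x2 b1' : ℕ) : ∀ b2 b2' b1, x2 ≤ b2 → b2' = b2 + m →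
    b1 = b1' + m → Es n l 1 m (Q n x1 x2 b2 b1) (Q n x1 x2 b2' b1') := by
  induction m with
  | zero => rintro b2 b2' b1 _ rfl rfl; simp [Es]
  | succ m ih =>
    rintro b2 b2' b1 h h1 h2
    obtain rfl : b1 = (b1' + m) + 1 := by omega
    exact ⟨_, e1b hn l x1 x2 b2 (b1' + m) h, ih _ _ _ (by omega) (by omega) rfl⟩

theorem mv (hn : 2 ≤ n) {l k i : ℕ} (hi : i ≤ n)
    {ι : Tup n × Tup n → Tup n × Tup n} (hι : IsIsoC n l k ι)
    {H : Tup n × Tup n → ℤ} (hH : IsEnergyC n l k ι H)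
    (p q p' q' : ℕ) {b1 b1' b2 b2' c1 c1' c2 c2' : Tup n} {h h' : ℤ}
    (m1 : memC n l b1) (m2 : memC n k b2) (m3 : memC n k c1) (m4 : memC n l c2)
    (E1 : Es n k i p b2 b2') (E2 : Es n l i q b1 b1')
    (E3 : Es n l i p' c2 c2') (E4 : Es n k i q' c1 c1')
    (h1 : p = 0 ∨ phiF n l i b1 ≤ epsF n k i b2') (h2 : q = 0 ∨ epsF n k i b2' ≤ phiF n l i b1)
    (h3 : p' = 0 ∨ phiF n k i c1 ≤ epsF n l i c2') (h4 : q' = 0 ∨ epsF n l i c2' ≤ phiF n k i c1)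
    (hpq : p + q = p' + q')
    (hh : h' = h + (if i = 0 then ((min q q' : ℕ) : ℤ) - ((min p p' : ℕ) : ℤ) else 0)) :
    PP n l k ι H (b1, b2) (c1, c2) h ↔ PP n l k ι H (b1', b2') (c1', c2') h' :=
  PP_RL hn hi hι hH (p + q) p q p' q' _ _ _ _ h h' rfl hpq.symm
    (RL_mk hn hi p q _ _ _ _ m1 m2 E1 E2 h1 h2) (RL_mk hn hi p' q' _ _ _ _ m3 m4 E3 E4 h3 h4) hh

/-- full `0`-string -/
theorem Zstr (hn : 2 ≤ n) {l k : ℕ} (hkl : k ≤ l)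
    {ι : Tup n × Tup n → Tup n × Tup n} (hι : IsIsoC n l k ι)
    {H : Tup n × Tup n → ℤ} (hH : IsEnergyC n l k ι H) (a c d : ℕ) (had : d ≤ a)
    (hs : a + c + d = k) (h : ℤ) :
    PP n l k ι H (Q n l 0 0 0, Q n a c 0 d) (Q n k 0 0 0, Q n (a + (l - k)) c 0 d) (h + a - d - k) ↔
    PP n l k ι H (Q n 0 0 0 l, Q n d c 0 a) (Q n 0 0 0 k, Q n d c 0 (a + (l - k))) h := by
  refine mv hn (Nat.zero_le _) hι hH (a - d) l (a + (l - k) - d) k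
    (mem_Q hn (by omega) (by omega)) (mem_Q hn (by omega) (by omega))
    (mem_Q hn (by omega) (by omega)) (mem_Q hn (by omega) (by omega))
    (E0swap hn _ _ _ _ _ _ (by omega) (by omega)) (E0swap hn _ _ _ _ _ _ (by omega) (by omega))
    (E0swap hn _ _ _ _ _ _ (by omega) (by omega)) (E0swap hn _ _ _ _ _ _ (by omega) (by omega))
    ?_ ?_ ?_ ?_ (by omega) ?_
  · rw [eps0_Q hn, phi0_Q hn]; omega
  · rw [eps0_Q hn, phi0_Q hn]; omega
  · rw [eps0_Q hn, phi0_Q hn]; omega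
  · rw [eps0_Q hn, phi0_Q hn]; omega
  · rw [if_pos rfl]; omega

theorem e0_full (hn : 2 ≤ n) {l : ℕ} (hl : 1 ≤ l) (b : Tup n) (hb : memC n l b) :
    epsF n l 0 b ≤ l ∧ (epsF n l 0 b = l → b = Q n l 0 0 0) := by
  obtain ⟨f, g⟩ := b
  obtain ⟨h1, h2⟩ := hb
  rw [tsum_sm] at h1 h2
  simp only at h1 h2
  simp only [epsF, if_true, tsum_sm, xc_en, xbc_en]
  have a1 := en_le f 1
  refine ⟨by omega, fun h => ?_⟩
  have e1 : en f 1 = l := by omega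
  have e2 : sm g = 0 := by omega
  have e3 : sm f = l := by omega
  have S := sm_setx f 1 0 le_rfl (by omega)
  have e4 : sm (setx f 1 0) = 0 := by omega
  ext t
  · by_cases ht : (t : ℕ) = 0
    · simp only [Q, ht, if_true]
      rw [← e1]; unfold en; rw [dif_pos (by omega)]; congr; exact Fin.ext ht
    · have : setx f 1 0 t = 0 := by
        unfold sm at e4
        rw [Finset.sum_eq_zero_iff] at e4
        exact e4 t (Finset.mem_univ _)
      simp only [setx] at this
      rw [if_neg (by omega)] at this
      simp [Q, ht, this]
  · unfold sm at e2
    rw [Finset.sum_eq_zero_iff] at e2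
    have := e2 t (Finset.mem_univ _)
    simp only [Q, this]; split_ifs <;> rfl

theorem base (hn : 2 ≤ n) {l k : ℕ} (hk : 1 ≤ k) (hkl : k ≤ l)
    {ι : Tup n × Tup n → Tup n × Tup n} (hι : IsIsoC n l k ι) :
    ι (Q n l 0 0 0, Q n k 0 0 0) = (Q n k 0 0 0, Q n l 0 0 0) := by
  have ml : memC n l (Q n l 0 0 0) := mem_Q hn (by omega) (by omega)
  have mk : memC n k (Q n k 0 0 0) := mem_Q hn (by omega) (by omega)
  have r : RL n l k 0 k l (Q n l 0 0 0, Q n k 0 0 0) (Q n 0 0 0 l, Q n 0 0 0 k) := by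
    refine RL_mk hn (Nat.zero_le _) k l _ _ _ _ ml mk
      (E0swap hn _ _ _ _ _ _ (by omega) (by omega)) (E0swap hn _ _ _ _ _ _ (by omega) (by omega))
      ?_ ?_
    · rw [eps0_Q hn, phi0_Q hn]; omega
    · rw [eps0_Q hn, phi0_Q hn]; omega
  have mu : ((Q n l 0 0 0, Q n k 0 0 0) : Tup n × Tup n) ∈ BC n l ×ˢ BC n k := ⟨ml, mk⟩
  have := RL_eps hn (Nat.zero_le _) hι (k + l) _ _ _ _ rfl r mu
  have mi := hι.1.mapsTo mu
  have a1 := e0_full hn (by omega) _ mi.1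
  have a2 := e0_full hn (by omega) _ mi.2
  exact Prod.ext (a1.2 (by omega)) (a2.2 (by omega))

end QQ

section Mid
variable {n : ℕ}

def Vb (n i p q A : ℕ) : Tup n :=
  (fun _ => 0, fun s => if (s : ℕ) = 0 then A else if (s : ℕ) + 1 = i then p
    else if (s : ℕ) + 1 = i + 1 then q else 0)

def Vx (n i p q A : ℕ) : Tup n :=
  (fun s => if (s : ℕ) + 1 = i then p else if (s : ℕ) + 1 = i + 1 then q else 0,
    fun s => if (s : ℕ) = 0 then A else 0)

def VN (n p q A : ℕ) : Tup n :=
  (fun s => if (s : ℕ) + 1 = n then p else 0,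
    fun s => if (s : ℕ) = 0 then A else if (s : ℕ) + 1 = n then q else 0)

theorem EVb (l i A : ℕ) (hi : 2 ≤ i) (hin : i < n) (p : ℕ) : ∀ q,
    Es n l i p (Vb n i p q A) (Vb n (i + 1) (p + q) 0 A) := by
  induction p with
  | zero =>
    intro q
    simp only [Es]
    ext t <;> simp only [Vb] <;> split_ifs <;> omega
  | succ p ih =>
    intro q
    have h := ih (q + 1)
    have e : p + (q + 1) = p + 1 + q := by omega
    rw [e] at h
    refine ⟨_, ?_, h⟩
    have v1 : xbc (Vb n i (p + 1) q A) i = p + 1 := by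
      simp only [xbc, Vb]; rw [dif_pos (by omega), if_neg (by omega), if_pos (by omega)]
    have v2 : xbc (Vb n i (p + 1) q A) (i + 1) = q := by
      simp only [xbc, Vb]; rw [dif_pos (by omega), if_neg (by omega), if_neg (by omega), if_pos (by omega)]
    have v3 : xc (Vb n i (p + 1) q A) (i + 1) = 0 := by
      simp only [xc, Vb]; split_ifs <;> rfl
    unfold eC
    rw [v1, v2, v3, if_neg (by omega), if_neg (by omega), if_pos hin, if_neg (by omega), if_pos (by omega)]
    congr 1; ext t <;> simp only [Vb, setx]
    split_ifs <;> omega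

theorem EVx (l i A : ℕ) (hi : 2 ≤ i) (hin : i < n) (q : ℕ) : ∀ p,
    Es n l i q (Vx n i p q A) (Vx n i (p + q) 0 A) := by
  induction q with
  | zero => intro p; simp [Es]
  | succ q ih =>
    intro p
    have h := ih (p + 1)
    have e : p + 1 + q = p + (q + 1) := by omega
    rw [e] at h
    refine ⟨_, ?_, h⟩
    have v1 : xc (Vx n i p (q + 1) A) i = p := by
      simp only [xc, Vx]; rw [dif_pos (by omega), if_pos (by omega)]
    have v2 : xc (Vx n i p (q + 1) A) (i + 1) = q + 1 := by
      simp only [xc, Vx]; rw [dif_pos (by omega), if_neg (by omega), if_pos (by omega)]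
    have v3 : xbc (Vx n i p (q + 1) A) (i + 1) = 0 := by
      simp only [xbc, Vx]; rw [dif_pos (by omega), if_neg (by omega)]
    unfold eC
    rw [v1, v2, v3, if_neg (by omega), if_neg (by omega), if_pos hin, if_pos (by omega)]
    congr 1; ext t <;> simp only [Vx, setx]
    split_ifs <;> omega

theorem EVN (hn : 2 ≤ n) (l A : ℕ) (q : ℕ) : ∀ p,
    Es n l n q (VN n p q A) (VN n (p + q) 0 A) := by
  induction q with
  | zero => intro p; simp [Es]
  | succ q ih =>
    intro p
    have h := ih (p + 1)
    have e : p + 1 + q = p + (q + 1) := by omega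
    rw [e] at h
    refine ⟨_, ?_, h⟩
    have v1 : xc (VN n p (q + 1) A) n = p := by
      simp only [xc, VN]; rw [dif_pos (by omega), if_pos (by omega)]
    have v2 : xbc (VN n p (q + 1) A) n = q + 1 := by
      simp only [xbc, VN]; rw [dif_pos (by omega), if_neg (by omega), if_pos (by omega)]
    unfold eC
    rw [v1, v2, if_neg (by omega), if_pos rfl, if_pos (by omega)]
    congr 1; ext t <;> simp only [VN, setx] <;> split_ifs <;> omega

theorem phi_bar (hn : 2 ≤ n) (l i A : ℕ) (hi : 2 ≤ i) (hin : i ≤ n) :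
    phiF n l i (Q n 0 0 0 A) = 0 := by
  have h1 : ∀ j, xc (Q n 0 0 0 A) j = 0 := by
    intro j; simp [xc, Q]
  have h2 : xbc (Q n 0 0 0 A) (i + 1) = 0 := by
    simp only [xbc, Q]; split_ifs <;> first | rfl | omega
  unfold phiF
  rw [h1, h1, h1, h2]
  split_ifs <;> omega

theorem mid1 (hn : 2 ≤ n) {l k i : ℕ} (hi : 2 ≤ i) (hin : i ≤ n)
    {ι : Tup n × Tup n → Tup n × Tup n} (hι : IsIsoC n l k ι)
    {H : Tup n × Tup n → ℤ} (hH : IsEnergyC n l k ι H) {m : ℕ} {b2 b2' c2 c2' : Tup n} {h : ℤ}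
    (m2 : memC n k b2) (m4 : memC n l c2)
    (E1 : Es n k i m b2 b2') (E3 : Es n l i m c2 c2')
    (hP : PP n l k ι H (Q n 0 0 0 l, b2) (Q n 0 0 0 k, c2) h) :
    memC n k b2' ∧ memC n l c2' ∧ PP n l k ι H (Q n 0 0 0 l, b2') (Q n 0 0 0 k, c2') h := by
  refine ⟨(Es_mem hn hin _ _ _ m2 E1).1, (Es_mem hn hin _ _ _ m4 E3).1, ?_⟩
  refine (mv hn hin hι hH m 0 m 0 (mem_Q hn (by omega) (by omega)) m2
    (mem_Q hn (by omega) (by omega)) m4 E1 rfl E3 rfl ?_ (Or.inl rfl) ?_ (Or.inl rfl) rfl ?_).1 hP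
  · right; rw [phi_bar hn _ _ _ hi hin]; omega
  · right; rw [phi_bar hn _ _ _ hi hin]; omega
  · rw [if_neg (by omega)]; omega

theorem mid (hn : 2 ≤ n) {l k : ℕ}
    {ι : Tup n × Tup n → Tup n × Tup n} (hι : IsIsoC n l k ι)
    {H : Tup n × Tup n → ℤ} (hH : IsEnergyC n l k ι H) (m A B : ℕ) {h : ℤ}
    (hA : m + A = k) (hB : m + B = l)
    (hP : PP n l k ι H (Q n 0 0 0 l, Q n 0 0 m A) (Q n 0 0 0 k, Q n 0 0 m B) h) :
    PP n l k ι H (Q n 0 0 0 l, Q n 0 m 0 A) (Q n 0 0 0 k, Q n 0 m 0 B) h := by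
  have s1 : ∀ j, 2 ≤ j → j ≤ n → memC n k (Vb n j m 0 A) ∧ memC n l (Vb n j m 0 B) ∧
      PP n l k ι H (Q n 0 0 0 l, Vb n j m 0 A) (Q n 0 0 0 k, Vb n j m 0 B) h := by
    intro j hj
    induction j, hj using Nat.le_induction with
    | base =>
      intro _
      have e : ∀ A, Vb n 2 m 0 A = Q n 0 0 m A := by
        intro A; ext t <;> simp only [Vb, Q] <;> split_ifs <;> omega
      rw [e, e]
      exact ⟨mem_Q hn (by omega) (by omega), mem_Q hn (by omega) (by omega), hP⟩
    | succ j hj ih =>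
      intro hjn
      obtain ⟨a, b, c⟩ := ih (by omega)
      exact mid1 hn hj (by omega) hι hH a b (EVb k j A hj (by omega) m 0) (EVb l j B hj (by omega) m 0) c
  obtain ⟨a, b, c⟩ := s1 n hn le_rfl
  have e : ∀ A, Vb n n m 0 A = VN n 0 m A := by
    intro A; ext t <;> simp only [Vb, VN] <;> split_ifs <;> omega
  have e' : ∀ A, VN n (0 + m) 0 A = Vx n n m 0 A := by
    intro A; ext t <;> simp only [Vx, VN] <;> split_ifs <;> omega
  rw [e, e] at c
  rw [e] at a b
  have s2 := mid1 hn hn le_rfl hι hH a b (EVN hn k A m 0) (EVN hn l B m 0) c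
  rw [e', e'] at s2
  have s3 : ∀ t j, 2 ≤ j → j + t = n → memC n k (Vx n j m 0 A) ∧ memC n l (Vx n j m 0 B) ∧
      PP n l k ι H (Q n 0 0 0 l, Vx n j m 0 A) (Q n 0 0 0 k, Vx n j m 0 B) h := by
    intro t
    induction t with
    | zero => rintro j _ rfl; exact s2
    | succ t ih =>
      intro j hj hjn
      obtain ⟨a, b, c⟩ := ih (j + 1) (by omega) (by omega)
      have e : ∀ A, Vx n (j + 1) m 0 A = Vx n j 0 m A := by
        intro A; ext t <;> simp only [Vx] <;> split_ifs <;> omega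
      rw [e] at a b
      rw [e, e] at c
      have := mid1 hn hj (by omega) hι hH a b (EVx k j A hj (by omega) m 0) (EVx l j B hj (by omega) m 0) c
      simpa using this
  obtain ⟨_, _, c⟩ := s3 (n - 2) 2 le_rfl (by omega)
  have e : ∀ A, Vx n 2 m 0 A = Q n 0 m 0 A := by
    intro A; ext t <;> simp only [Vx, Q] <;> split_ifs <;> omega
  rw [e, e] at c
  exact c

/-- type I highest elements, up to normalization -/
theorem T0' (hn : 2 ≤ n) {l k : ℕ} (hk : 1 ≤ k) (hkl : k ≤ l)
    {ι : Tup n × Tup n → Tup n × Tup n} (hι : IsIsoC n l k ι)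
    {H : Tup n × Tup n → ℤ} (hH : IsEnergyC n l k ι H) (a c d : ℕ) (had : d ≤ a)
    (hs : a + c + d = k) :
    PP n l k ι H (Q n l 0 0 0, Q n a c 0 d) (Q n k 0 0 0, Q n (a + (l - k)) c 0 d)
      (H (Q n l 0 0 0, Q n k 0 0 0) + a - d - k) := by
  rw [Zstr hn hkl hι hH a c d had hs]
  have P0 : PP n l k ι H (Q n l 0 0 0, Q n k 0 0 0) (Q n k 0 0 0, Q n (k + (l - k)) 0 0 0)
      (H (Q n l 0 0 0, Q n k 0 0 0) + (k : ℕ) - (0 : ℕ) - k) := by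
    have e : k + (l - k) = l := by omega
    rw [e]
    exact ⟨base hn hk hkl hι, by push_cast; ring⟩
  rw [Zstr hn hkl hι hH k 0 0 (by omega) (by omega)] at P0
  generalize H (Q n l 0 0 0, Q n k 0 0 0) = h at *
  have P1 : PP n l k ι H (Q n 0 0 0 l, Q n 0 0 (c + d) a)
      (Q n 0 0 0 k, Q n 0 0 (c + d) (a + (l - k))) h := by
    refine (mv hn (by omega) hι hH (i := 1) (c + d) 0 (c + d) 0
      (mem_Q hn (by omega) (by omega)) (mem_Q hn (by omega) (by omega))
      (mem_Q hn (by omega) (by omega)) (mem_Q hn (by omega) (by omega))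
      (E1b hn _ _ _ _ _ _ _ _ (by omega) (by omega) (by omega)) rfl
      (E1b hn _ _ _ _ _ _ _ _ (by omega) (by omega) (by omega)) rfl ?_ (Or.inl rfl) ?_ (Or.inl rfl) rfl
      (by simp)).1 P0
    · rw [eps1_Q hn, phi1_Q hn]; omega
    · rw [eps1_Q hn, phi1_Q hn]; omega
  have P2 := mid hn hι hH _ _ _ (by omega) (by omega) P1
  refine (mv hn (by omega) hι hH (i := 1) d 0 d 0
      (mem_Q hn (by omega) (by omega)) (mem_Q hn (by omega) (by omega))
      (mem_Q hn (by omega) (by omega)) (mem_Q hn (by omega) (by omega))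
      (E1x hn _ _ _ _ _ (by omega) _ _ _ (by omega) (by omega)) rfl
      (E1x hn _ _ _ _ _ (by omega) _ _ _ (by omega) (by omega)) rfl ?_ (Or.inl rfl) ?_ (Or.inl rfl) rfl
      (by simp)).1 P2
  · rw [eps1_Q hn, phi1_Q hn]; omega
  · rw [eps1_Q hn, phi1_Q hn]; omega

theorem T0 (hn : 2 ≤ n) {l k : ℕ} (hk : 1 ≤ k) (hkl : k ≤ l)
    {ι : Tup n × Tup n → Tup n × Tup n} (hι : IsIsoC n l k ι)
    {H : Tup n × Tup n → ℤ} (hH : IsEnergyC n l k ι H) (a c d : ℕ) (had : d ≤ a)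
    (hs : a + c + d = k) :
    PP n l k ι H (Q n l 0 0 0, Q n a c 0 d) (Q n k 0 0 0, Q n (a + (l - k)) c 0 d)
      ((a : ℤ) - d) := by
  have h0 := (T0' hn hk hkl hι hH 0 k 0 le_rfl (by omega)).2
  have e1 : uvec n l = Q n l 0 0 0 := by
    ext t <;> simp only [uvec, Q] <;> split_ifs <;> rfl
  have e2 : u2vec n k = Q n 0 k 0 0 := by
    ext t <;> simp only [u2vec, Q] <;> split_ifs <;> first | rfl | omega
  have h1 := hH.2
  rw [e1, e2, h0] at h1
  have := T0' hn hk hkl hι hH a c d had hs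
  refine ⟨this.1, ?_⟩
  rw [this.2]
  push_cast at h1
  omega

set_option maxHeartbeats 2000000 in
/-- terminal elements -/
theorem TB (hn : 2 ≤ n) {l k : ℕ} (hk : 1 ≤ k) (hkl : k ≤ l)
    {ι : Tup n × Tup n → Tup n × Tup n} (hι : IsIsoC n l k ι)
    {H : Tup n × Tup n → ℤ} (hH : IsEnergyC n l k ι H) (y a c d : ℕ) (had : d + y ≤ a)
    (hs : a + c + d = k) (hr : c + d + 2 * y ≤ l) (w : ℕ) (hw : w = min (l - k) (2 * y + d - a)) :
    PP n l k ι H (Q n (l - 2 * y) 0 0 0, Q n a c 0 d)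
      (Q n (k + 2 * w - 2 * y) 0 0 0, Q n (a + (l - k - w)) c 0 (d + w))
      (max ((y : ℤ) + (k : ℤ) - (l : ℤ)) ((a : ℤ) - (d : ℤ) - (y : ℤ))) := by
  obtain ⟨m, hm⟩ : ∃ m, m = min (2 * y) (a - d) := ⟨_, rfl⟩
  obtain ⟨r, hr'⟩ : ∃ r, r = l - 2 * y - c - d := ⟨_, rfl⟩
  obtain ⟨s, hs'⟩ : ∃ s, s = a - d := ⟨_, rfl⟩
  obtain ⟨r', hr2⟩ : ∃ r', r' = a + w - 2 * y := ⟨_, rfl⟩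
  obtain ⟨j, hj⟩ : ∃ j, j = l - k + s - w := ⟨_, rfl⟩
  have U := T0 hn hk hkl hι hH (a - m) (c + m) d (by omega) (by omega)
  have A2 : PP n l k ι H (Q n (c + d + 2 * y) r 0 0, Q n d (c + s) 0 d)
      (Q n (c + d + 2 * y - w) r' 0 0, Q n (d + w) (c + j) 0 d) (((a - m : ℕ) : ℤ) - d) := by
    refine (mv hn (by omega) hι hH (i := 1) (s - m) r (j - m) r'
      (mem_Q hn (by omega) (by omega)) (mem_Q hn (by omega) (by omega))
      (mem_Q hn (by omega) (by omega)) (mem_Q hn (by omega) (by omega))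
      (E1x hn _ _ _ _ _ (by omega) _ _ _ (by omega) (by omega))
      (E1x hn _ _ _ _ _ (by omega) _ _ _ (by omega) (by omega))
      (E1x hn _ _ _ _ _ (by omega) _ _ _ (by omega) (by omega))
      (E1x hn _ _ _ _ _ (by omega) _ _ _ (by omega) (by omega))
      ?_ ?_ ?_ ?_ (by omega) (by simp)).2 U
    · rw [eps1_Q hn, phi1_Q hn]; omega
    · rw [eps1_Q hn, phi1_Q hn]; omega
    · rw [eps1_Q hn, phi1_Q hn]; omega
    · rw [eps1_Q hn, phi1_Q hn]; omega
  have A1 : PP n l k ι H (Q n (c + d) r 0 0, Q n d (c + s) 0 d)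
      (Q n (c + d + w) r' 0 0, Q n d (c + j) 0 (d + w)) 
      (max ((y : ℤ) + (k : ℤ) - (l : ℤ)) ((a : ℤ) - (d : ℤ) - (y : ℤ))) := by
    refine (mv hn (by omega) hι hH (i := 0) 0 y w (y - w)
      (mem_Q hn (by omega) (by omega)) (mem_Q hn (by omega) (by omega))
      (mem_Q hn (by omega) (by omega)) (mem_Q hn (by omega) (by omega))
      rfl
      (E0shift hn _ _ _ _ _ _ _ (by omega) (by omega))
      (E0swap hn _ _ _ _ _ _ (by omega) (by omega))
      (E0shift hn _ _ _ _ _ _ _ (by omega) (by omega))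
      ?_ ?_ ?_ ?_ (by omega) ?_).1 A2
    · rw [eps0_Q hn, phi0_Q hn]; omega
    · rw [eps0_Q hn, phi0_Q hn]; omega
    · rw [eps0_Q hn, phi0_Q hn]; omega
    · rw [eps0_Q hn, phi0_Q hn]; omega
    · rw [if_pos rfl]; omega
  refine (mv hn (by omega) hι hH (i := 1) s r j r'
      (mem_Q hn (by omega) (by omega)) (mem_Q hn (by omega) (by omega))
      (mem_Q hn (by omega) (by omega)) (mem_Q hn (by omega) (by omega))
      (E1x hn _ _ _ _ _ (by omega) _ _ _ (by omega) (by omega))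
      (E1x hn _ _ _ _ _ (by omega) _ _ _ (by omega) (by omega))
      (E1x hn _ _ _ _ _ (by omega) _ _ _ (by omega) (by omega))
      (E1x hn _ _ _ _ _ (by omega) _ _ _ (by omega) (by omega))
      ?_ ?_ ?_ ?_ (by omega) (by simp)).1 A1
  · rw [eps1_Q hn, phi1_Q hn]; omega
  · rw [eps1_Q hn, phi1_Q hn]; omega
  · rw [eps1_Q hn, phi1_Q hn]; omega
  · rw [eps1_Q hn, phi1_Q hn]; omega

theorem TC (hn : 2 ≤ n) {l k : ℕ} (hk : 1 ≤ k) (hkl : k ≤ l)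
    {ι : Tup n × Tup n → Tup n × Tup n} (hι : IsIsoC n l k ι)
    {H : Tup n × Tup n → ℤ} (hH : IsEnergyC n l k ι H) (y a c d : ℕ) (had : a ≤ d + y)
    (hs : a + c + d = k) (hr : c + d + 2 * y ≤ l) (hy : l - k ≤ y) :
    PP n l k ι H (Q n (l - 2 * y) 0 0 0, Q n a c 0 d)
      (Q n (k + 2 * (l - k) - 2 * y) 0 0 0, Q n a c 0 (d + (l - k)))
      ((y : ℤ) + (k : ℤ) - (l : ℤ)) := by
  rcases Nat.lt_or_ge a d with h1 | h1
  · have U := T0 hn hk hkl hι hH d c a (by omega) (by omega)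
    refine (mv hn (by omega) hι hH (i := 0) (d - a) y (d - a + (l - k)) (y - (l - k))
      (mem_Q hn (by omega) (by omega)) (mem_Q hn (by omega) (by omega))
      (mem_Q hn (by omega) (by omega)) (mem_Q hn (by omega) (by omega))
      (E0swap hn _ _ _ _ _ _ (by omega) (by omega))
      (E0shift hn _ _ _ _ _ _ _ (by omega) (by omega))
      (E0swap hn _ _ _ _ _ _ (by omega) (by omega))
      (E0shift hn _ _ _ _ _ _ _ (by omega) (by omega))
      ?_ ?_ ?_ ?_ (by omega) ?_).1 U
    · rw [eps0_Q hn, phi0_Q hn]; omega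
    · rw [eps0_Q hn, phi0_Q hn]; omega
    · rw [eps0_Q hn, phi0_Q hn]; omega
    · rw [eps0_Q hn, phi0_Q hn]; omega
    · rw [if_pos rfl]; omega
  · have U := TB hn hk hkl hι hH (a - d) a c d (by omega) hs (by omega) _ rfl
    rcases Nat.lt_or_ge (a - d) (l - k) with h2 | h2
    · have hw : min (l - k) (2 * (a - d) + d - a) = a - d := by omega
      rw [hw] at U
      have ea : d + (a - d) = a := by omega
      rw [ea] at U
      refine (mv hn (by omega) hι hH (i := 0) 0 (y - (a - d)) (l - k - (a - d)) (y - (l - k))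
        (mem_Q hn (by omega) (by omega)) (mem_Q hn (by omega) (by omega))
        (mem_Q hn (by omega) (by omega)) (mem_Q hn (by omega) (by omega))
        rfl
        (E0shift hn _ _ _ _ _ _ _ (by omega) (by omega))
        ?_
        (E0shift hn _ _ _ _ _ _ _ (by omega) (by omega))
        ?_ ?_ ?_ ?_ (by omega) ?_).1 U
      · have e : d + (l - k) = a + (l - k - (a - d)) := by omega
        rw [e]
        exact E0swap hn _ _ _ _ _ _ (by omega) (by omega)
      · rw [eps0_Q hn, phi0_Q hn]; omega
      · rw [eps0_Q hn, phi0_Q hn]; omega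
      · rw [eps0_Q hn, phi0_Q hn]; omega
      · rw [eps0_Q hn, phi0_Q hn]; omega
      · rw [if_pos rfl]; omega
    · have hw : min (l - k) (2 * (a - d) + d - a) = l - k := by omega
      rw [hw] at U
      have ea : a + (l - k - (l - k)) = a := by omega
      rw [ea] at U
      refine (mv hn (by omega) hι hH (i := 0) 0 (y - (a - d)) 0 (y - (a - d))
        (mem_Q hn (by omega) (by omega)) (mem_Q hn (by omega) (by omega))
        (mem_Q hn (by omega) (by omega)) (mem_Q hn (by omega) (by omega))
        rfl
        (E0shift hn _ _ _ _ _ _ _ (by omega) (by omega))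
        rfl
        (E0shift hn _ _ _ _ _ _ _ (by omega) (by omega))
        ?_ ?_ ?_ ?_ (by omega) ?_).1 U
      · rw [eps0_Q hn, phi0_Q hn]; omega
      · rw [eps0_Q hn, phi0_Q hn]; omega
      · rw [eps0_Q hn, phi0_Q hn]; omega
      · rw [eps0_Q hn, phi0_Q hn]; omega
      · rw [if_pos rfl]; omega

end Mid

/-- **Lemma 4.5, case 2** (type II highest elements).  If `l-k ≤ y₀` or `y₀ < x_1 - x̄_1`
then, with `w = min(l-k, (2y₀ - x_1 + x̄_1)_+)`, the isomorphism maps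
`(l-2y₀,0,---,0) ⊗ (x_1,x_2,---,x̄_1)` to
`(k-2y₀+2w,0,---,0) ⊗ (x_1+l-k-w, x_2, ---, x̄_1+w)` and the energy is
`max(y₀-l+k, x_1-x̄_1-y₀)`. -/
theorem lemma_4_5_case2
    (n l k : ℕ) (hn : 2 ≤ n) (hk : 1 ≤ k) (hkl : k ≤ l)
    (ι : Tup n × Tup n → Tup n × Tup n) (hι : IsIsoC n l k ι)
    (H : Tup n × Tup n → ℤ) (hH : IsEnergyC n l k ι H)
    (y a c : ℕ) (hy : 1 ≤ y) (hac : a + c ≤ k)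
    (hyl : 2 * (y : ℤ) - (a : ℤ) ≤ (l : ℤ) - (k : ℤ))
    (d : ℕ) (hd : d = k - a - c)
    (hcase : l - k ≤ y ∨ (y : ℤ) < (a : ℤ) - (d : ℤ))
    (w : ℕ) (hw : w = min (l - k) (2 * y + d - a)) :
    ι (uvec n (l - 2 * y), tripleVec n a c d) =
      (uvec n (k + 2 * w - 2 * y), tripleVec n (a + (l - k - w)) c (d + w)) ∧
    H (uvec n (l - 2 * y), tripleVec n a c d) =
      max ((y : ℤ) + (k : ℤ) - (l : ℤ)) ((a : ℤ) - (d : ℤ) - (y : ℤ)) := by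
  have e1 : ∀ v, uvec n v = Q n v 0 0 0 := by
    intro v; ext t <;> simp only [uvec, Q] <;> split_ifs <;> rfl
  have e2 : ∀ a c d, tripleVec n a c d = Q n a c 0 d := by
    intro a c d; ext t <;> simp only [tripleVec, Q] <;> split_ifs <;> rfl
  rw [e1, e1, e2, e2]
  rcases Nat.lt_or_ge (d + y) a with h | h
  · exact TB hn hk hkl hι hH y a c d (by omega) (by omega) (by omega) w hw
  · have hw' : w = l - k := by omega
    subst hw'
    have := TC hn hk hkl hι hH y a c d (by omega) (by omega) (by omega) (by omega)
    have ea : a + (l - k - (l - k)) = a := by omega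
    rw [ea]
    refine ⟨this.1, ?_⟩
    rw [this.2]
    omega
end KTT
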